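/- arXiv:0808.2213 — 6 statements merged into one kernel-verified Lean document; each statement's English description precedes it below -/
import Mathlib

section
/- (Chebyshev–Markov alternation theorem) Let u_0, ..., u_N be a Chebyshev system on [a,b] with span U, and let f ∈ C([a,b], ℝ). Set δ = inf_{u ∈ U} ‖f − u‖_∞, where ‖·‖_∞ is the supremum norm on [a,b]. Then an element u_0* ∈ U satisfies ‖f − u_0*‖_∞ = δ if and only if there exist N+2 points t_1 < t_2 < ... < t_{N+2} in [a,b] and a sign ε ∈ {−1, +1} such that f(t_j) − u_0*(t_j) = ε·(−1)^j·δ for all j = 1, ..., N+2. -/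
open Filter in
/-- A point of a normed space has a best approximation in any finite-dimensional subspace. -/
theorem Submodule.exists_forall_norm_sub_le {E : Type*} [NormedAddCommGroup E] [NormedSpace ℝ E]
    (U : Submodule ℝ E) [FiniteDimensional ℝ U] (f : E) :
    ∃ v : U, ∀ w : U, ‖f - v‖ ≤ ‖f - w‖ := by
  have : ProperSpace U := FiniteDimensional.proper ℝ U
  refine Continuous.exists_forall_le (f := fun v : U => ‖f - v‖) (by fun_prop) ?_
  refine tendsto_atTop_mono (f := fun v : U => ‖v‖ + -‖f‖) (fun v => ?_)
    (tendsto_atTop_add_const_right _ _ (tendsto_norm_cocompact_atTop))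
  have := norm_sub_norm_le (v : E) f
  rw [norm_sub_rev] at this
  simpa [sub_eq_add_neg] using this

/-- In a finite-dimensional space the convex hull of a compact set is compact. -/
theorem IsCompact.convexHull_of_finiteDimensional {E : Type*} [NormedAddCommGroup E]
    [NormedSpace ℝ E] [FiniteDimensional ℝ E] {s : Set E} (hs : IsCompact s) :
    IsCompact (convexHull ℝ s) := by
  let ι := Fin (Module.finrank ℝ E + 1)
  have himage : convexHull ℝ s = (fun p : (ι → ℝ) × (ι → E) => ∑ i, p.1 i • p.2 i) ''
      (stdSimplex ℝ ι ×ˢ Set.univ.pi fun _ => s) := by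
    refine Set.Subset.antisymm (fun x hx => ?_) ?_
    · obtain ⟨z₀, hz₀⟩ := convexHull_nonempty_iff.1 ⟨x, hx⟩
      obtain ⟨κ, _, z, w, hzs, hz, hw, hw1, rfl⟩ := eq_pos_convex_span_of_mem_convexHull hx
      have hcard : Fintype.card κ ≤ Fintype.card ι := by
        simpa [ι] using hz.card_le_finrank_succ.trans
          (Nat.add_le_add_right (Submodule.finrank_le _) 1)
      obtain ⟨e⟩ := Function.Embedding.nonempty_of_card_le hcard
      have he := e.injective
      have hout : ∀ i ∉ Set.range e, Function.extend e w 0 i = 0 := fun i hi => by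
        rw [Function.extend_apply' _ _ _ (by simpa using hi)]; rfl
      refine ⟨(Function.extend e w 0, Function.extend e z fun _ => z₀),
        ⟨⟨fun i => ?_, ?_⟩, fun i _ => ?_⟩, ?_⟩
      · by_cases hi : i ∈ Set.range e
        · obtain ⟨k, rfl⟩ := hi
          simpa [he.extend_apply] using (hw k).le
        · exact (hout i hi).ge
      · rw [← hw1]
        exact (Fintype.sum_of_injective e he _ _ hout
          fun k => (he.extend_apply _ _ _).symm).symm
      · by_cases hi : i ∈ Set.range e
        · obtain ⟨k, rfl⟩ := hi
          simpa [he.extend_apply] using hzs ⟨k, rfl⟩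
        · simpa [Function.extend_apply' z (fun _ => z₀) i (by simpa using hi)] using hz₀
      · refine (Fintype.sum_of_injective e he _ _ (fun i hi => ?_) fun k => ?_).symm
        · simp [hout i hi]
        · simp [he.extend_apply]
    · rintro _ ⟨⟨w, z⟩, ⟨hw, hz⟩, rfl⟩
      exact (convex_convexHull ℝ s).sum_mem (fun i _ => hw.1 i) hw.2
        fun i _ => subset_convexHull ℝ s (hz i trivial)
  rw [himage]
  exact ((isCompact_stdSimplex ℝ ι).prod (isCompact_univ_pi fun _ => hs)).image (by fun_prop)

/-- If `v` has the same sign as `e` wherever `|e|` is maximal, then `e` can be made smaller in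
norm by subtracting a multiple of `v`. -/
theorem ContinuousMap.exists_norm_sub_smul_lt {X : Type*} [TopologicalSpace X] [CompactSpace X]
    [Nonempty X] {e v : C(X, ℝ)} (h : ∀ x, |e x| = ‖e‖ → 0 < e x * v x) :
    ∃ r : ℝ, ‖e - r • v‖ < ‖e‖ := by
  obtain ⟨x₀, hx₀⟩ := (show Continuous fun x => max (e x * v x) (‖e‖ - |e x|) by
    fun_prop).exists_forall_le_of_hasCompactSupport (HasCompactSupport.of_compactSpace _)
  have hle : ∀ (g : C(X, ℝ)) x, |g x| ≤ ‖g‖ := fun g x => g.norm_coe_le_norm x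
  set c := max (e x₀ * v x₀) (‖e‖ - |e x₀|)
  have hc : 0 < c := by
    rcases (hle e x₀).lt_or_eq with hlt | heq
    · exact lt_max_of_lt_right (by linarith)
    · exact lt_max_of_lt_left (h x₀ heq)
  set M := ‖v‖
  have hM : 0 ≤ M := norm_nonneg v
  set r := c / (M ^ 2 + M + 1)
  have hr : 0 < r := by positivity
  have hrc : r * (M ^ 2 + M + 1) = c := div_mul_cancel₀ _ (by positivity)
  refine ⟨r, (ContinuousMap.norm_lt_iff_of_nonempty _).2 fun x => ?_⟩
  have hv := hle v x
  rw [Real.norm_eq_abs]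
  change |e x - r * v x| < ‖e‖
  rcases le_max_iff.1 (hx₀ x) with hx | hx
  · apply abs_lt_of_sq_lt_sq _ (norm_nonneg e)
    have h1 : e x ^ 2 ≤ ‖e‖ ^ 2 := sq_le_sq.2 (by simpa using hle e x)
    have h2 : v x ^ 2 ≤ M ^ 2 := sq_le_sq.2 (by simpa [M] using hv)
    have h3 : r * v x ^ 2 < 2 * (e x * v x) := by nlinarith
    nlinarith
  · calc |e x - r * v x| ≤ |e x| + |r * v x| := abs_sub _ _
      _ ≤ (‖e‖ - c) + r * M := by
        rw [abs_mul, abs_of_pos hr]; gcongr; linarith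
      _ < ‖e‖ := by nlinarith

/-- A Chebyshev system of order `N`: every nontrivial linear combination has at most `N` zeros. -/
def IsChebyshevSystem {X : Type*} [TopologicalSpace X] {N : ℕ} (u : Fin (N + 1) → C(X, ℝ)) :
    Prop :=
  ∀ α : Fin (N + 1) → ℝ, α ≠ 0 → {x : X | ∑ j, α j * u j x = 0}.encard ≤ (N : ℕ∞)

namespace IsChebyshevSystem

variable {N : ℕ}

section

variable {X : Type*} [TopologicalSpace X] {u : Fin (N + 1) → C(X, ℝ)}

theorem eq_zero_of_injective (hu : IsChebyshevSystem u) {x : Fin (N + 1) → X}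
    (hx : Function.Injective x) {α : Fin (N + 1) → ℝ} (h : ∀ i, ∑ j, α j * u j (x i) = 0) :
    α = 0 := by
  by_contra hα
  have h1 : (Set.range x).encard ≤ N :=
    (Set.encard_le_encard (by rintro _ ⟨i, rfl⟩; exact h i)).trans (hu α hα)
  rw [← Set.image_univ, hx.encard_image, Set.encard_univ, ENat.card_eq_coe_fintype_card,
    Fintype.card_fin, Nat.cast_le] at h1
  omega

theorem exists_interpolation (hu : IsChebyshevSystem u) {x : Fin (N + 1) → X}
    (hx : Function.Injective x) (y : Fin (N + 1) → ℝ) :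
    ∃ α : Fin (N + 1) → ℝ, ∀ i, ∑ j, α j * u j (x i) = y i := by
  let A : Matrix (Fin (N + 1)) (Fin (N + 1)) ℝ := .of fun i j => u j (x i)
  have hA : ∀ α i, A.mulVecLin α i = ∑ j, α j * u j (x i) := fun α i => by
    simp [A, Matrix.mulVec, dotProduct, mul_comm]
  have hinj : Function.Injective A.mulVecLin := by
    rw [← LinearMap.ker_eq_bot, LinearMap.ker_eq_bot']
    exact fun α hα => hu.eq_zero_of_injective hx fun i => by rw [← hA, hα]; rfl
  obtain ⟨α, hα⟩ := LinearMap.injective_iff_surjective.1 hinj y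
  exact ⟨α, fun i => by rw [← hA, hα]⟩

end

variable {a b : ℝ} {u : Fin (N + 1) → C(Set.Icc a b, ℝ)}

/-- A linear combination vanishing at `N` of the points `t₀ < ⋯ < t_{N+1}`, and equal to `1` at
one of the two remaining consecutive ones, is positive at the other one. -/
theorem pos_of_interpolation (hu : IsChebyshevSystem u) {t : Fin (N + 2) → Set.Icc a b}
    (ht : StrictMono t) (j : Fin (N + 1)) {α : Fin (N + 1) → ℝ}
    (hα : ∀ i, ∑ k, α k * u k (t (j.succ.succAbove i)) = Pi.single (M := fun _ => ℝ) j 1 i) :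
    0 < ∑ k, α k * u k (t j.succ) := by
  have hαj : ∑ k, α k * u k (t j.castSucc) = 1 := by simpa using hα j
  by_contra! hneg
  have hlt : t j.castSucc < t j.succ := ht j.castSucc_lt_succ
  have hab : a ≤ b := (t 0).2.1.trans (t 0).2.2
  obtain ⟨z, ⟨hz1, hz2⟩, hz⟩ := intermediate_value_Icc' (α := ℝ) (δ := ℝ)
    (f := fun s => ∑ k, α k * u k (Set.projIcc a b hab s)) (Subtype.coe_le_coe.2 hlt.le)
    (by fun_prop) (show (0 : ℝ) ∈ _ by simp [Set.projIcc_val, hneg, hαj])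
  have hzmem : z ∈ Set.Icc a b := ⟨(t _).2.1.trans hz1, hz2.trans (t _).2.2⟩
  simp only [Set.projIcc_of_mem hab hzmem] at hz
  have hne : (⟨z, hzmem⟩ : Set.Icc a b) ≠ t j.castSucc := by
    intro h; rw [h, hαj] at hz; exact one_ne_zero hz
  have hlt' : t j.castSucc < ⟨z, hzmem⟩ := lt_of_le_of_ne hz1 hne.symm
  have hle' : (⟨z, hzmem⟩ : Set.Icc a b) ≤ t j.succ := hz2
  have hnew : ∀ i, i ≠ j → t (j.succ.succAbove i) ≠ ⟨z, hzmem⟩ := by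
    intro i hi
    rcases hi.lt_or_gt with h | h
    · rw [Fin.succAbove_of_castSucc_lt _ _ ((Fin.castSucc_lt_castSucc_iff.2 h).trans j.castSucc_lt_succ)]
      exact ((ht (Fin.castSucc_lt_castSucc_iff.2 h)).trans hlt').ne
    · rw [Fin.succAbove_of_le_castSucc _ _ (Fin.succ_le_castSucc_iff.2 h)]
      exact (hle'.trans_lt (ht (Fin.succ_lt_succ_iff.2 h))).ne'
  have hinj : Function.Injective (Function.update (t ∘ j.succ.succAbove) j ⟨z, hzmem⟩) := by
    have hinj₀ := ht.injective.comp (Fin.succAbove_right_injective (p := j.succ))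
    intro i i' h
    by_cases hi : i = j <;> by_cases hi' : i' = j
    · rw [hi, hi']
    · subst hi; simp [hi'] at h; exact absurd h.symm (hnew i' hi')
    · subst hi'; simp [hi] at h; exact absurd h (hnew i hi)
    · simp only [Function.update_of_ne hi, Function.update_of_ne hi'] at h
      exact hinj₀ h
  have h0 := hu.eq_zero_of_injective hinj (α := α) fun i => by
    by_cases hi : i = j
    · subst hi; simpa using hz
    · simp only [Function.update_of_ne hi, Function.comp_apply, hα i, Pi.single_eq_of_ne hi]
  simp [h0] at hαj

/-- The coefficients of a nontrivial linear relation between the values at `N + 2` increasing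
points alternate in sign. -/
theorem exists_alternating (hu : IsChebyshevSystem u) {t : Fin (N + 2) → Set.Icc a b}
    (ht : StrictMono t) {c : Fin (N + 2) → ℝ} (hc : c ≠ 0)
    (hrel : ∀ k, ∑ i, c i * u k (t i) = 0) :
    ∃ ε : ℝ, (ε = 1 ∨ ε = -1) ∧ ∀ j : Fin (N + 2), 0 < ε * (-1) ^ (j : ℕ) * c j := by
  have hstep : ∀ j : Fin (N + 1), ∃ r > 0, c j.castSucc = -(r * c j.succ) := by
    intro j
    obtain ⟨α, hα⟩ := hu.exists_interpolation
      (ht.injective.comp (Fin.succAbove_right_injective (p := j.succ))) (Pi.single j 1)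
    refine ⟨_, hu.pos_of_interpolation ht j hα, ?_⟩
    have h : ∑ i, c i * ∑ k, α k * u k (t i) = 0 := by
      simp_rw [Finset.mul_sum]
      rw [Finset.sum_comm]
      refine Finset.sum_eq_zero fun k _ => ?_
      rw [← mul_zero (α k), ← hrel k, Finset.mul_sum]
      exact Finset.sum_congr rfl fun i _ => by ring
    rw [Fin.sum_univ_succAbove _ j.succ] at h
    simp only [Function.comp_apply] at hα
    simp_rw [hα] at h
    simp [Pi.single_apply] at h
    linarith
  have hc0 : c 0 ≠ 0 := by
    intro h0
    refine hc (funext fun j => ?_)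
    induction j using Fin.induction with
    | zero => exact h0
    | succ j ih =>
      obtain ⟨r, hr, h⟩ := hstep j
      simpa [ih, hr.ne'] using h
  have hind : ∀ ε : ℝ, 0 < ε * c 0 → ∀ j : Fin (N + 2), 0 < ε * (-1) ^ (j : ℕ) * c j := by
    intro ε hε j
    induction j using Fin.induction with
    | zero => simpa using hε
    | succ j ih =>
      obtain ⟨r, hr, h⟩ := hstep j
      rw [h] at ih
      refine pos_of_mul_pos_right (a := r) ?_ hr.le
      rw [Fin.val_castSucc] at ih
      rw [Fin.val_succ, pow_succ]
      linarith
  rcases hc0.lt_or_gt with h | h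
  · exact ⟨-1, .inr rfl, hind _ (by linarith)⟩
  · exact ⟨1, .inl rfl, hind _ (by linarith)⟩

/-- A linear combination which weakly alternates in sign at `N + 2` increasing points is zero. -/
theorem eq_zero_of_weakly_alternating (hu : IsChebyshevSystem u)
    {t : Fin (N + 2) → Set.Icc a b} (ht : StrictMono t) {α : Fin (N + 1) → ℝ} {η : ℝ}
    (hη : η ≠ 0) (h : ∀ j : Fin (N + 2), 0 ≤ η * (-1) ^ (j : ℕ) * ∑ k, α k * u k (t j)) :
    α = 0 := by
  let A : Matrix (Fin (N + 1)) (Fin (N + 2)) ℝ := .of fun k i => u k (t i)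
  obtain ⟨c, hcA, hc⟩ := (Submodule.ne_bot_iff _).1
    (LinearMap.ker_ne_bot_of_finrank_lt (f := A.mulVecLin) (by simp))
  have hrel : ∀ k, ∑ i, c i * u k (t i) = 0 := fun k => by
    simpa [A, Matrix.mulVec, dotProduct, mul_comm] using congrFun (LinearMap.mem_ker.1 hcA) k
  obtain ⟨ε, -, hpos⟩ := hu.exists_alternating ht hc hrel
  have hsign : ∀ j : ℕ, ((-1 : ℝ) ^ j) * (-1) ^ j = 1 := fun j => by
    rw [← mul_pow]; simp
  have hsum : ∑ i : Fin (N + 2), (ε * (-1) ^ (i : ℕ) * c i) *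
      (η * (-1) ^ (i : ℕ) * ∑ k, α k * u k (t i)) = 0 := by
    calc _ = (ε * η) * ∑ i, c i * ∑ k, α k * u k (t i) := by
          rw [Finset.mul_sum]
          refine Finset.sum_congr rfl fun i _ => ?_
          linear_combination (ε * c i * η * ∑ k, α k * u k (t i)) * hsign i
      _ = (ε * η) * ∑ k, α k * ∑ i, c i * u k (t i) := by
          simp_rw [Finset.mul_sum]
          rw [Finset.sum_comm]
          exact Finset.sum_congr rfl fun k _ => Finset.sum_congr rfl fun i _ => by ring
      _ = 0 := by simp [hrel]
  rw [Finset.sum_eq_zero_iff_of_nonneg fun i _ => mul_nonneg (hpos i).le (h i)] at hsum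
  refine hu.eq_zero_of_injective (x := t ∘ Fin.castSucc)
    (ht.injective.comp (Fin.castSucc_injective _)) fun i => ?_
  simpa [(hpos i.castSucc).ne', hη] using
    (mul_eq_zero.1 (hsum i.castSucc (Finset.mem_univ _))).resolve_left (hpos i.castSucc).ne'

/-- If no linear combination of the `u k` has the sign of `e` at all extremal points of `e ≠ 0`,
then `e` alternates between its extremal values at `N + 2` points. -/
theorem exists_alternant (hab : a < b) (hu : IsChebyshevSystem u) {e : C(Set.Icc a b, ℝ)}
    (he : e ≠ 0)
    (hbest : ∀ α : Fin (N + 1) → ℝ, ∃ x, |e x| = ‖e‖ ∧ e x * ∑ k, α k * u k x ≤ 0) :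
    ∃ t : Fin (N + 2) → Set.Icc a b, StrictMono t ∧
      ∃ ε : ℝ, (ε = 1 ∨ ε = -1) ∧ ∀ j : Fin (N + 2), e (t j) = ε * (-1) ^ (j : ℕ) * ‖e‖ := by
  have : Infinite (Set.Icc a b) := Set.infinite_coe_iff.2 (Set.Icc_infinite hab)
  let φ : Set.Icc a b → Fin (N + 1) → ℝ := fun x k => e x * u k x
  let K := φ '' {x | |e x| = ‖e‖}
  have hK : IsCompact K :=
    (isClosed_eq (by fun_prop) (by fun_prop)).isCompact.image (by fun_prop)
  have h0 : (0 : Fin (N + 1) → ℝ) ∈ convexHull ℝ K := by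
    by_contra h0
    obtain ⟨g, s, hg0, hg⟩ := geometric_hahn_banach_point_closed (convex_convexHull ℝ K)
      hK.convexHull_of_finiteDimensional.isClosed h0
    obtain ⟨x, hx, hle⟩ := hbest fun k => g (Pi.single k 1)
    have h1 := hg _ (subset_convexHull ℝ K ⟨x, hx, rfl⟩)
    have h2 : g (φ x) = e x * ∑ k, g (Pi.single k 1) * u k x := by
      conv_lhs => rw [pi_eq_sum_univ' (φ x)]
      simp only [map_sum, map_smul, smul_eq_mul, φ, Finset.mul_sum]
      exact Finset.sum_congr rfl fun k _ => by ring
    rw [map_zero] at hg0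
    linarith
  obtain ⟨ι, _, z, w, hz, hind, hw, hw1, hsum⟩ := eq_pos_convex_span_of_mem_convexHull h0
  choose x hx hxz using fun i => hz ⟨i, rfl⟩
  have hxinj : Function.Injective x := fun i j h => hind.injective (by rw [← hxz, ← hxz, h])
  classical
  have hcard : (Finset.univ.image x).card ≤ N + 2 := by
    rw [Finset.card_image_of_injective _ hxinj, Finset.card_univ]
    simpa using hind.card_le_finrank_succ.trans (Nat.add_le_add_right (Submodule.finrank_le _) 1)
  obtain ⟨T, hT, hTcard⟩ := Infinite.exists_superset_card_eq _ _ hcard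
  let t : Fin (N + 2) → Set.Icc a b := T.orderEmbOfFin hTcard
  have ht : StrictMono t := (T.orderEmbOfFin hTcard).strictMono
  have hmem : ∀ i, ∃ j, t j = x i := fun i => by
    have : x i ∈ Set.range t := by
      simp only [t, Finset.range_orderEmbOfFin]
      exact hT (Finset.mem_image_of_mem _ (Finset.mem_univ i))
    exact this
  choose p hp using hmem
  have hpinj : Function.Injective p := fun i j h => hxinj (by rw [← hp, ← hp, h])
  let c : Fin (N + 2) → ℝ := Function.extend p (fun i => w i * e (x i)) 0
  have hcp : ∀ i, c (p i) = w i * e (x i) := fun i => hpinj.extend_apply _ _ _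
  have hcout : ∀ j ∉ Set.range p, c j = 0 := fun j hj => by
    simp only [c]
    rw [Function.extend_apply' _ _ _ (by simpa using hj)]; rfl
  have hepos : 0 < ‖e‖ := norm_pos_iff.2 he
  have hrel : ∀ k, ∑ j, c j * u k (t j) = 0 := fun k => by
    have h := congrFun hsum k
    simp only [Finset.sum_apply, Pi.smul_apply, Pi.zero_apply, smul_eq_mul] at h
    rw [← h]
    refine (Fintype.sum_of_injective p hpinj _ _ (fun j hj => by simp [hcout j hj])
      fun i => ?_).symm
    rw [hcp, hp, ← hxz]
    simp only [φ]; ring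
  have hc : c ≠ 0 := by
    intro h
    have : Nonempty ι := by
      by_contra hι
      rw [not_nonempty_iff] at hι
      simp at hw1
    obtain ⟨i⟩ := this
    have h1 : w i * e (x i) = 0 := by rw [← hcp, h]; rfl
    have h2 : |e (x i)| = ‖e‖ := hx i
    rw [(mul_eq_zero.1 h1).resolve_left (hw i).ne', abs_zero] at h2
    exact hepos.ne h2
  obtain ⟨ε, hε, hpos⟩ := hu.exists_alternating ht hc hrel
  refine ⟨t, ht, ε, hε, fun j => ?_⟩
  obtain ⟨i, rfl⟩ : j ∈ Set.range p := by
    by_contra hj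
    simpa [hcout j hj] using hpos j
  have h1 := hpos (p i)
  rw [hcp] at h1
  have h3 : 0 < ε * (-1) ^ (p i : ℕ) * e (x i) :=
    pos_of_mul_pos_right (a := w i) (by linarith) (hw i).le
  have hx' : |e (x i)| = ‖e‖ := hx i
  rw [hp, ← hx']
  have hσ : ε * (-1) ^ (p i : ℕ) = 1 ∨ ε * (-1) ^ (p i : ℕ) = -1 := by
    rcases hε with rfl | rfl <;> rcases neg_one_pow_eq_or ℝ (p i : ℕ) with h | h <;> simp [h]
  rcases hσ with h | h <;> rw [h] at h3 ⊢
  · rw [abs_of_pos (by linarith)]; ring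
  · rw [abs_of_neg (by linarith)]; ring

end IsChebyshevSystem


/-- **Chebyshev–Markov alternation theorem.** Let `u₀, …, u_N` be a Chebyshev system on
`[a,b]` (every nontrivial linear combination has at most `N` zeros) with span `U`, let
`f` be continuous on `[a,b]` and let `δ` be the distance (in sup norm) from `f` to `U`.
Then `u₀* ∈ U` is a best approximation to `f` iff there are `N+2` increasing points of
`[a,b]` at which `f - u₀*` alternately attains `±δ`. -/
theorem chebyshev_markov_alternation (a b : ℝ) (hab : a < b) (N : ℕ)
    (u : Fin (N + 1) → C(Set.Icc a b, ℝ))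
    (hcheb : ∀ α : Fin (N + 1) → ℝ, α ≠ 0 →
      {x : Set.Icc a b | ∑ j : Fin (N + 1), α j * u j x = 0}.encard ≤ (N : ℕ∞))
    (f : C(Set.Icc a b, ℝ)) (δ : ℝ)
    (hδ : δ = ⨅ v : Submodule.span ℝ (Set.range u), ‖f - (v : C(Set.Icc a b, ℝ))‖)
    (u₀ : C(Set.Icc a b, ℝ)) (hu₀ : u₀ ∈ Submodule.span ℝ (Set.range u)) :
    ‖f - u₀‖ = δ ↔
      ∃ t : Fin (N + 2) → Set.Icc a b, StrictMono t ∧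
        ∃ ε : ℝ, (ε = 1 ∨ ε = -1) ∧
          ∀ j : Fin (N + 2), f (t j) - u₀ (t j) = ε * (-1) ^ (j : ℕ) * δ := by
  have hu : IsChebyshevSystem u := hcheb
  have hδle : ∀ v ∈ Submodule.span ℝ (Set.range u), δ ≤ ‖f - v‖ := fun v hv => by
    rw [hδ]
    exact ciInf_le (f := fun v : Submodule.span ℝ (Set.range u) => ‖f - v‖)
      ⟨0, by rintro _ ⟨v, rfl⟩; exact norm_nonneg _⟩ ⟨v, hv⟩
  have : Nonempty (Set.Icc a b) := ⟨⟨a, le_rfl, hab.le⟩⟩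
  constructor
  · rintro rfl
    by_cases he : f - u₀ = 0
    · have : Infinite (Set.Icc a b) := Set.infinite_coe_iff.2 (Set.Icc_infinite hab)
      obtain ⟨T, hT⟩ := Infinite.exists_subset_card_eq (Set.Icc a b) (N + 2)
      refine ⟨T.orderEmbOfFin hT, (T.orderEmbOfFin hT).strictMono, 1, .inl rfl, fun j => ?_⟩
      simp [sub_eq_zero.1 he]
    · refine hu.exists_alternant hab he fun α => ?_
      by_contra! h
      have hmem : ∑ k, α k • u k ∈ Submodule.span ℝ (Set.range u) :=
        Submodule.sum_mem _ fun k _ => Submodule.smul_mem _ _ (Submodule.subset_span ⟨k, rfl⟩)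
      obtain ⟨r, hr⟩ := ContinuousMap.exists_norm_sub_smul_lt (e := f - u₀)
        (v := ∑ k, α k • u k) fun x hx => by simpa using h x hx
      refine absurd (hδle _ (Submodule.add_mem _ hu₀ (Submodule.smul_mem _ r hmem))) ?_
      rw [← sub_sub]
      exact hr.not_ge
  · rintro ⟨t, ht, ε, hε, h⟩
    have : FiniteDimensional ℝ (Submodule.span ℝ (Set.range u)) :=
      FiniteDimensional.span_of_finite ℝ (Set.finite_range u)
    obtain ⟨v, hv⟩ := (Submodule.span ℝ (Set.range u)).exists_forall_norm_sub_le f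
    have hvδ : ‖f - v‖ ≤ δ := by rw [hδ]; exact le_ciInf hv
    obtain ⟨α, hα⟩ := (Submodule.mem_span_range_iff_exists_fun ℝ).1 (Submodule.sub_mem _ v.2 hu₀)
    have hαx : ∀ x, ∑ k, α k * u k x = v.1 x - u₀ x := fun x => by
      simpa using congrArg (fun g : C(Set.Icc a b, ℝ) => g x) hα
    have hα0 : α = 0 := by
      refine hu.eq_zero_of_weakly_alternating ht (η := ε) (by rcases hε with rfl | rfl <;> simp)
        fun j => ?_
      have h1 : |f (t j) - v.1 (t j)| ≤ δ := ((f - v.1).norm_coe_le_norm (t j)).trans hvδ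
      have h2 := h j
      have hσ : ε * (-1) ^ (j : ℕ) = 1 ∨ ε * (-1) ^ (j : ℕ) = -1 := by
        rcases hε with rfl | rfl <;> rcases neg_one_pow_eq_or ℝ (j : ℕ) with h | h <;> simp [h]
      rw [abs_le] at h1
      rw [hαx]
      rcases hσ with h' | h' <;> rw [h'] at h2 ⊢ <;> linarith
    have hvu : v.1 = u₀ := by
      rw [← sub_eq_zero, ← hα]; simp [hα0]
    exact le_antisymm (hvu ▸ hvδ) (hδle _ hu₀)
end

section
/- (Haar's theorem, uniqueness direction) Let u_0, ..., u_N be a Chebyshev system on [a,b] with span U. Then for every f ∈ C([a,b], ℝ) there exists a unique u* ∈ U such that ‖f − u*‖_∞ = inf_{u ∈ U} ‖f − u‖_∞, where ‖·‖_∞ is the supremum norm on [a,b]. -/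
open Filter in
/-- A finite-dimensional subspace contains a best approximation to every vector. -/
theorem exists_norm_sub_eq_iInf_of_finiteDimensional {E : Type*} [NormedAddCommGroup E]
    [NormedSpace ℝ E] (U : Submodule ℝ E) [FiniteDimensional ℝ U] (f : E) :
    ∃ v : U, ‖f - (v : E)‖ = ⨅ w : U, ‖f - (w : E)‖ := by
  have := FiniteDimensional.proper_real U
  have hlim : Tendsto (fun w : U => ‖f - (w : E)‖) (cocompact U) atTop := by
    have h : Tendsto (fun w : U => ‖w‖ - ‖f‖) (cocompact U) atTop :=
      tendsto_atTop_add_const_right _ _ (tendsto_norm_cocompact_atTop (E := U))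
    refine tendsto_atTop_mono (fun w => ?_) h
    rw [norm_sub_rev]
    exact norm_sub_norm_le (w : E) f
  have hcont : Continuous fun w : U => ‖f - (w : E)‖ := by fun_prop
  obtain ⟨v, hv⟩ := hcont.exists_forall_le hlim
  exact ⟨v, le_antisymm (le_ciInf hv)
    (ciInf_le ⟨0, Set.forall_mem_range.2 fun _ => norm_nonneg _⟩ v)⟩

/-- A Chebyshev system of order `N` interpolates arbitrary values on any set of at most `N + 1`
points. -/
theorem exists_sum_mul_eq_of_card_le {X : Type*} [Infinite X] {N : ℕ} {u : Fin (N + 1) → X → ℝ}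
    (hu : ∀ α : Fin (N + 1) → ℝ, α ≠ 0 → {x | ∑ j, α j * u j x = 0}.encard ≤ (N : ℕ∞))
    (s : Finset X) (hs : s.card ≤ N + 1) (g : X → ℝ) :
    ∃ α : Fin (N + 1) → ℝ, ∀ x ∈ s, ∑ j, α j * u j x = g x := by
  obtain ⟨t, hst, ht⟩ := Infinite.exists_superset_card_eq s (N + 1) hs
  let L : (Fin (N + 1) → ℝ) →ₗ[ℝ] (t → ℝ) :=
    LinearMap.pi fun x => ∑ j, u j x • LinearMap.proj j
  have hL (α) (x : t) : L α x = ∑ j, α j * u j x := by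
    simp [L, mul_comm]
  have hinj : Function.Injective L := by
    rw [injective_iff_map_eq_zero]
    intro α hα
    by_contra hne
    have hsub : (t : Set X) ⊆ {x | ∑ j, α j * u j x = 0} := fun x hx => by
      simpa [hα] using (hL α ⟨x, hx⟩).symm
    have hcard := (Set.encard_le_encard hsub).trans (hu α hne)
    rw [Set.encard_coe_eq_coe_finsetCard, ht] at hcard
    exact absurd (by exact_mod_cast hcard : N + 1 ≤ N) (by lia)
  have hsurj : Function.Surjective L :=
    (LinearMap.injective_iff_surjective_of_finrank_eq_finrank (by simp [ht])).1 hinj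
  obtain ⟨α, hα⟩ := hsurj fun x => g x
  exact ⟨α, fun x hx => by rw [← hL α ⟨x, hst hx⟩, hα]⟩

/-- If `p` agrees with `g ≠ 0` wherever `|g|` attains its maximum, then moving `g` in the direction
`-p` decreases its norm. -/
theorem ContinuousMap.exists_norm_sub_smul_lt_s5 {X : Type*} [TopologicalSpace X] [CompactSpace X]
    {g p : C(X, ℝ)} (hg : g ≠ 0) (hp : ∀ x, |g x| = ‖g‖ → p x = g x) :
    ∃ t : ℝ, ‖g - t • p‖ < ‖g‖ := by
  have hd : 0 < ‖g‖ := norm_pos_iff.2 hg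
  have hK : IsCompact {x | g x * p x ≤ ‖g‖ ^ 2 / 2} :=
    (isClosed_le (by fun_prop) (by fun_prop)).isCompact
  have hlt : ∀ x ∈ {x | g x * p x ≤ ‖g‖ ^ 2 / 2}, 0 < ‖g‖ - |g x| := by
    intro x hx
    refine sub_pos.2 ((g.norm_coe_le_norm x).lt_of_ne fun h => ?_)
    have hx' : g x * p x ≤ ‖g‖ ^ 2 / 2 := hx
    rw [hp x h, ← sq, ← sq_abs, ← Real.norm_eq_abs, h] at hx'
    nlinarith
  obtain ⟨e, he, hKe⟩ := hK.exists_forall_le' (f := fun x => ‖g‖ - |g x|) (by fun_prop) hlt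
  have hsmall : ∀ᶠ t : ℝ in nhdsWithin 0 (Set.Ioi 0), t * ‖p‖ < e ∧ t * ‖p‖ ^ 2 < ‖g‖ ^ 2 := by
    refine nhdsWithin_le_nhds (Filter.Eventually.and ?_ ?_)
    · exact (Continuous.tendsto (by fun_prop : Continuous fun t : ℝ => t * ‖p‖)
        0).eventually_lt_const (by simpa using he)
    · exact (Continuous.tendsto (by fun_prop : Continuous fun t : ℝ => t * ‖p‖ ^ 2)
        0).eventually_lt_const (by simp only [zero_mul]; positivity)
  obtain ⟨t, ⟨h1, h2⟩, ht⟩ := (hsmall.and self_mem_nhdsWithin).exists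
  have ht : 0 < t := ht
  refine ⟨t, (ContinuousMap.norm_lt_iff _ hd).2 fun x => ?_⟩
  have hpx : |p x| ≤ ‖p‖ := p.norm_coe_le_norm x
  have hgx : |g x| ≤ ‖g‖ := g.norm_coe_le_norm x
  simp only [ContinuousMap.sub_apply, ContinuousMap.smul_apply, smul_eq_mul, Real.norm_eq_abs]
  by_cases hx : g x * p x ≤ ‖g‖ ^ 2 / 2
  · have h3 : e ≤ ‖g‖ - |g x| := hKe x hx
    calc |g x - t * p x| ≤ |g x| + |t * p x| := abs_sub _ _
      _ = |g x| + t * |p x| := by rw [abs_mul, abs_of_pos ht]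
      _ ≤ |g x| + t * ‖p‖ := by gcongr
      _ < ‖g‖ := by linarith
  · refine abs_lt_of_sq_lt_sq ?_ hd.le
    have h4 : p x ^ 2 ≤ ‖p‖ ^ 2 := sq_le_sq' (abs_le.1 hpx).1 (abs_le.1 hpx).2
    have h5 : g x ^ 2 ≤ ‖g‖ ^ 2 := sq_le_sq' (abs_le.1 hgx).1 (abs_le.1 hgx).2
    have h6 : t * (t * p x ^ 2) ≤ t * (t * ‖p‖ ^ 2) := by gcongr
    have h7 : t * (t * ‖p‖ ^ 2) < t * ‖g‖ ^ 2 := by gcongr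
    have h8 : t * (‖g‖ ^ 2 / 2) < t * (g x * p x) := by gcongr; exact not_le.1 hx
    nlinarith

/-- Two best approximations have the same midpoint error, hence agree, at every point where the
error of their midpoint is extremal. -/
theorem eq_of_abs_sub_midpoint_eq {c y z d : ℝ} (hy : |c - y| ≤ d) (hz : |c - z| ≤ d)
    (h : |c - (1 / 2) * (y + z)| = d) : y = z := by
  rw [abs_le] at hy hz
  rcases abs_cases (c - (1 / 2) * (y + z)) with h' | h' <;> linarith


/-- **Haar's theorem (existence and uniqueness of best approximation).** If `u₀, …, u_N`
is a Chebyshev system on `[a,b]` with span `U`, then every continuous `f` on `[a,b]` has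
a unique best uniform approximation from `U`. -/
theorem haar_unique_best_approximation (a b : ℝ) (hab : a < b) (N : ℕ)
    (u : Fin (N + 1) → C(Set.Icc a b, ℝ))
    (hcheb : ∀ α : Fin (N + 1) → ℝ, α ≠ 0 →
      {x : Set.Icc a b | ∑ j : Fin (N + 1), α j * u j x = 0}.encard ≤ (N : ℕ∞))
    (f : C(Set.Icc a b, ℝ)) :
    ∃! v : Submodule.span ℝ (Set.range u),
      ‖f - (v : C(Set.Icc a b, ℝ))‖ =
        ⨅ w : Submodule.span ℝ (Set.range u), ‖f - (w : C(Set.Icc a b, ℝ))‖ := by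
  set U := Submodule.span ℝ (Set.range u)
  have : Infinite (Set.Icc a b) := (Set.Icc_infinite hab).to_subtype
  have : FiniteDimensional ℝ U := FiniteDimensional.span_of_finite ℝ (Set.finite_range u)
  have hle (w : U) : ⨅ w : U, ‖f - (w : C(Set.Icc a b, ℝ))‖ ≤ ‖f - (w : C(Set.Icc a b, ℝ))‖ :=
    ciInf_le ⟨0, Set.forall_mem_range.2 fun _ => norm_nonneg _⟩ w
  obtain ⟨v, hv⟩ := exists_norm_sub_eq_iInf_of_finiteDimensional U f
  refine ⟨v, hv, fun w hw => ?_⟩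
  set d := ⨅ w : U, ‖f - (w : C(Set.Icc a b, ℝ))‖
  let m : U := (1 / 2 : ℝ) • (w + v)
  let g : C(Set.Icc a b, ℝ) := f - m
  have hgx (x) : g x = f x - (1 / 2) * ((w : C(Set.Icc a b, ℝ)) x + (v : C(Set.Icc a b, ℝ)) x) := by
    simp [g, m, mul_add]
  have hwx (x) : |f x - (w : C(Set.Icc a b, ℝ)) x| ≤ d :=
    hw ▸ (f - (w : C(Set.Icc a b, ℝ))).norm_coe_le_norm x
  have hvx (x) : |f x - (v : C(Set.Icc a b, ℝ)) x| ≤ d :=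
    hv ▸ (f - (v : C(Set.Icc a b, ℝ))).norm_coe_le_norm x
  have hg : ‖g‖ = d := by
    refine le_antisymm ((ContinuousMap.norm_le _ (hv ▸ norm_nonneg _)).2 fun x => ?_) (hle m)
    rw [Real.norm_eq_abs, hgx]
    have h1 := abs_le.1 (hwx x)
    have h2 := abs_le.1 (hvx x)
    exact abs_le.2 ⟨by linarith, by linarith⟩
  have hagree (x) (hx : |g x| = d) :
      (w : C(Set.Icc a b, ℝ)) x = (v : C(Set.Icc a b, ℝ)) x :=
    eq_of_abs_sub_midpoint_eq (hwx x) (hvx x) (hgx x ▸ hx)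
  obtain ⟨α, hα⟩ := (Submodule.mem_span_range_iff_exists_fun ℝ).1 (w - v).2
  have hαx (x) : ∑ j, α j * u j x =
      (w : C(Set.Icc a b, ℝ)) x - (v : C(Set.Icc a b, ℝ)) x := by
    simpa [ContinuousMap.sum_apply] using DFunLike.congr_fun hα x
  by_contra hne
  have hα0 : α ≠ 0 := by
    rintro rfl
    refine hne (sub_eq_zero.1 (Subtype.ext ?_))
    simpa using hα.symm
  have hext : {x | |g x| = d} ⊆ {x | ∑ j, α j * u j x = 0} := fun x hx => by
    simp [hαx, hagree x hx]
  have hcard := (Set.encard_le_encard hext).trans (hcheb α hα0)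
  have hfin : {x | |g x| = d}.Finite := Set.finite_of_encard_le_coe hcard
  have hg0 : g ≠ 0 := by
    intro h
    refine Set.infinite_univ (hfin.subset fun x _ => ?_)
    simp [← hg, h]
  rw [hfin.encard_eq_coe_toFinset_card] at hcard
  obtain ⟨β, hβ⟩ := exists_sum_mul_eq_of_card_le (u := fun j x => u j x) hcheb hfin.toFinset
    ((by exact_mod_cast hcard : hfin.toFinset.card ≤ N).trans N.le_succ) g
  let p : U := ⟨∑ j, β j • u j,
    Submodule.sum_mem _ fun j _ => U.smul_mem _ (Submodule.subset_span ⟨j, rfl⟩)⟩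
  obtain ⟨t, ht⟩ := ContinuousMap.exists_norm_sub_smul_lt_s5 (p := (p : C(Set.Icc a b, ℝ))) hg0
    fun x hx => by simpa [p, ContinuousMap.sum_apply] using hβ x (by simpa [← hg] using hx)
  refine absurd (hle (m + t • p)) (not_le.2 ?_)
  rw [← hg]
  simpa [g, sub_sub] using ht
end

section
/- Let 0 < s_0 < s_1 < ... < s_N be real numbers and let λ_0, ..., λ_N be real numbers, not all zero. Then the function u(t) = ∑_{j=0}^{N} λ_j / (s_j + t) has at most N zeros in the interval (0, ∞). -/
open Polynomial in
/-- The numerator of `∑ j, c j / (s j + X)` over the common denominator `∏ j, (s j + X)`. -/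
noncomputable def cauchyNumerator {ι K : Type*} [Fintype ι] [DecidableEq ι] [Field K]
    (s c : ι → K) : K[X] :=
  ∑ j, C (c j) * ∏ i ∈ Finset.univ.erase j, (X + C (s i))

section CauchyNumerator

variable {ι K : Type*} [Fintype ι] [DecidableEq ι] [Field K] (s c : ι → K)

theorem eval_cauchyNumerator (t : K) :
    (cauchyNumerator s c).eval t = ∑ j, c j * ∏ i ∈ Finset.univ.erase j, (t + s i) := by
  simp [cauchyNumerator, Polynomial.eval_finsetSum, Polynomial.eval_prod]

theorem natDegree_cauchyNumerator_le :
    (cauchyNumerator s c).natDegree ≤ Fintype.card ι - 1 := by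
  refine Polynomial.natDegree_sum_le_of_forall_le _ _ fun j _ ↦ ?_
  refine (Polynomial.natDegree_C_mul_le _ _).trans ?_
  rw [Polynomial.natDegree_prod_of_monic _ _ fun i _ ↦ Polynomial.monic_X_add_C (s i)]
  simp [Finset.card_erase_of_mem]

theorem eval_neg_cauchyNumerator (j : ι) :
    (cauchyNumerator s c).eval (-s j) = c j * ∏ i ∈ Finset.univ.erase j, (-s j + s i) := by
  rw [eval_cauchyNumerator]
  refine Finset.sum_eq_single j (fun k _ hk ↦ ?_) (by simp)
  rw [Finset.prod_eq_zero (Finset.mem_erase.2 ⟨hk.symm, Finset.mem_univ j⟩) (by simp), mul_zero]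

variable {s c}

theorem cauchyNumerator_ne_zero (hs : Function.Injective s) (hc : c ≠ 0) :
    cauchyNumerator s c ≠ 0 := by
  obtain ⟨j, hj⟩ := Function.ne_iff.1 hc
  intro h
  have hval := eval_neg_cauchyNumerator s c j
  rw [h, Polynomial.eval_zero] at hval
  refine mul_ne_zero hj (Finset.prod_ne_zero_iff.2 fun i hi ↦ ?_) hval.symm
  rw [neg_add_eq_sub, sub_ne_zero]
  exact hs.ne (Finset.ne_of_mem_erase hi)

theorem eval_cauchyNumerator_eq_prod_mul_sum {t : K} (ht : ∀ j, s j + t ≠ 0) :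
    (cauchyNumerator s c).eval t = (∏ i, (s i + t)) * ∑ j, c j / (s j + t) := by
  rw [eval_cauchyNumerator, Finset.mul_sum]
  refine Finset.sum_congr rfl fun j _ ↦ ?_
  rw [← Finset.mul_prod_erase _ _ (Finset.mem_univ j)]
  simp only [add_comm t]
  field_simp [ht j]

theorem encard_zeros_sum_div_add_le (hs : Function.Injective s) (hc : c ≠ 0) :
    {t | (∀ j, s j + t ≠ 0) ∧ ∑ j, c j / (s j + t) = 0}.encard ≤
      ((Fintype.card ι - 1 : ℕ) : ℕ∞) := by
  classical
  calc
    _ ≤ ((cauchyNumerator s c).roots.toFinset : Set K).encard := by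
      refine Set.encard_le_encard fun t ⟨ht, hsum⟩ ↦ ?_
      simp [cauchyNumerator_ne_zero hs hc, eval_cauchyNumerator_eq_prod_mul_sum ht, hsum]
    _ ≤ _ := by
      rw [Set.encard_coe_eq_coe_finsetCard]
      exact_mod_cast (Multiset.toFinset_card_le _).trans
        ((Polynomial.card_roots' _).trans (natDegree_cauchyNumerator_le s c))

end CauchyNumerator

/-- For `0 < s₀ < s₁ < ⋯ < s_N` and coefficients `λ₀, …, λ_N` not all zero, the function
`u t = ∑ j, λ j / (s j + t)` has at most `N` zeros in `(0, ∞)`. -/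
theorem cauchy_kernels_chebyshev (N : ℕ) (s : Fin (N + 1) → ℝ)
    (hs0 : 0 < s 0) (hs : StrictMono s)
    (lam : Fin (N + 1) → ℝ) (hlam : lam ≠ 0) :
    {t ∈ Set.Ioi (0 : ℝ) | ∑ j : Fin (N + 1), lam j / (s j + t) = 0}.encard ≤ (N : ℕ∞) := by
  have hcard := encard_zeros_sum_div_add_le hs.injective hlam
  rw [Fintype.card_fin, Nat.add_sub_cancel] at hcard
  refine le_trans (Set.encard_le_encard ?_) hcard
  rintro t ⟨ht, hsum⟩
  refine ⟨fun j ↦ ?_, hsum⟩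
  exact (add_pos (hs0.trans_le (hs.monotone (Fin.zero_le j))) ht).ne'
end

section
/- Let α_0 < α_1 < ... < α_N be real numbers and let λ_0, ..., λ_N be real numbers, not all zero. Then the function u(t) = ∑_{j=0}^{N} λ_j t^{α_j} (where t^{α} denotes the real power of t > 0) has at most N zeros in the interval (0, ∞). -/
/-- An exponential sum with `n` distinct exponents that vanishes at `n` distinct points has all
its coefficients equal to zero. -/
theorem eq_zero_of_sum_mul_exp_eq_zero {n : ℕ} {α c z : Fin n → ℝ} (hα : Function.Injective α)
    (hz : StrictMono z) (h : ∀ i, ∑ j, c j * Real.exp (α j * z i) = 0) : c = 0 := by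
  induction n with
  | zero => exact Subsingleton.elim _ _
  | succ n ih =>
    let g : ℝ → ℝ := fun x ↦ ∑ j, c j * Real.exp ((α j - α 0) * x)
    have g_zero (i) : g (z i) = 0 := by
      have : g (z i) = Real.exp (-α 0 * z i) * ∑ j, c j * Real.exp (α j * z i) := by
        simp only [g, Finset.mul_sum]
        refine Finset.sum_congr rfl fun j _ ↦ ?_
        rw [mul_left_comm, ← Real.exp_add]
        ring_nf
      rw [this, h, mul_zero]
    have g_deriv (x) : HasDerivAt g
        (∑ j : Fin n, c j.succ * (α j.succ - α 0) * Real.exp ((α j.succ - α 0) * x)) x := by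
      have : HasDerivAt g (∑ j, c j * (Real.exp ((α j - α 0) * x) * ((α j - α 0) * 1))) x :=
        HasDerivAt.fun_sum fun j _ ↦
          (((hasDerivAt_id x).const_mul (α j - α 0)).exp).const_mul (c j)
      convert this using 1
      rw [Fin.sum_univ_succ]
      simp only [sub_self, zero_mul, mul_zero, zero_add]
      exact Finset.sum_congr rfl fun j _ ↦ by ring
    have rolle (i : Fin n) : ∃ w ∈ Set.Ioo (z i.castSucc) (z i.succ),
        ∑ j : Fin n, c j.succ * (α j.succ - α 0) * Real.exp ((α j.succ - α 0) * w) = 0 :=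
      exists_hasDerivAt_eq_zero (hz i.castSucc_lt_succ)
        (fun x _ ↦ (g_deriv x).continuousAt.continuousWithinAt)
        ((g_zero _).trans (g_zero _).symm) fun x _ ↦ g_deriv x
    choose w hw hw_zero using rolle
    have w_mono : StrictMono w := fun i j hij ↦
      (hw i).2.trans_le ((hz.monotone (Fin.succ_le_castSucc_iff.2 hij)).trans (hw j).1.le)
    have tail := ih (α := fun j ↦ α j.succ - α 0) (c := fun j ↦ c j.succ * (α j.succ - α 0))
      (fun i j hij ↦ Fin.succ_injective _ (hα (sub_left_injective hij))) w_mono hw_zero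
    have c_succ (j : Fin n) : c j.succ = 0 :=
      (mul_eq_zero.1 (congrFun tail j)).resolve_right
        (sub_ne_zero.2 (hα.ne (Fin.succ_ne_zero j)))
    have c_zero : c 0 = 0 := by
      simpa [g, Fin.sum_univ_succ, c_succ] using g_zero 0
    exact funext fun j ↦ Fin.cases c_zero c_succ j

/-- For real exponents `α₀ < α₁ < ⋯ < α_N` and coefficients `λ₀, …, λ_N` not all zero,
the generalized polynomial `u t = ∑ j, λ j * t ^ (α j)` (real powers) has at most `N`
zeros in `(0, ∞)`. -/
theorem power_functions_chebyshev (N : ℕ) (α : Fin (N + 1) → ℝ) (hα : StrictMono α)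
    (lam : Fin (N + 1) → ℝ) (hlam : lam ≠ 0) :
    {t ∈ Set.Ioi (0 : ℝ) |
      ∑ j : Fin (N + 1), lam j * t ^ (α j) = 0}.encard ≤ (N : ℕ∞) := by
  by_contra! hcard
  obtain ⟨s, hs, hs_card⟩ := Set.exists_subset_encard_eq (Order.add_one_le_of_lt hcard)
  have hs_fin : s.Finite := Set.finite_of_encard_eq_coe (k := N + 1) (by exact_mod_cast hs_card)
  lift s to Finset ℝ using hs_fin
  have hs_card' : s.card = N + 1 := by
    rw [Set.encard_coe_eq_coe_finsetCard] at hs_card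
    exact_mod_cast hs_card
  let t := s.orderEmbOfFin hs_card'
  have ht (i) := hs (s.orderEmbOfFin_mem hs_card' i)
  refine hlam (eq_zero_of_sum_mul_exp_eq_zero (z := fun i ↦ Real.log (t i)) hα.injective
    (fun i j hij ↦ Real.log_lt_log (ht i).1 (t.strictMono hij)) fun i ↦ ?_)
  rw [← (ht i).2]
  refine Finset.sum_congr rfl fun j _ ↦ ?_
  rw [Real.rpow_def_of_pos (ht i).1, mul_comm (α j)]
end

section
/- Let s_0 < s_1 < ... < s_N be real numbers and let λ_0, ..., λ_N be real numbers, not all zero. Then the function u(t) = ∑_{j=0}^{N} λ_j exp(−(s_j − t)²) has at most N zeros in ℝ. -/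
/-- **Rolle's theorem, counted**: between `n + 1` zeros of a differentiable function lie
`n` zeros of its derivative. -/
theorem exists_finset_deriv_zeros {f f' : ℝ → ℝ} (hf : ∀ t, HasDerivAt f (f' t) t)
    {n : ℕ} {T : Finset ℝ} (hT : T.card = n + 1) (hz : ∀ t ∈ T, f t = 0) :
    ∃ T' : Finset ℝ, T'.card = n ∧ ∀ t ∈ T', f' t = 0 := by
  let x := T.orderEmbOfFin hT
  have hx : ∀ i, f (x i) = 0 := fun i => hz _ (T.orderEmbOfFin_mem hT i)
  have key : ∀ i : Fin n, ∃ y ∈ Set.Ioo (x i.castSucc) (x i.succ), f' y = 0 := fun i =>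
    exists_hasDerivAt_eq_zero (x.strictMono i.castSucc_lt_succ)
      (fun t _ => (hf t).continuousAt.continuousWithinAt) (by rw [hx, hx]) (fun t _ => hf t)
  choose y hy hy0 using key
  have hmono : StrictMono y := fun i j hij =>
    (hy i).2.trans_le ((x.monotone (Fin.succ_le_castSucc_iff.mpr hij)).trans (hy j).1.le)
  refine ⟨Finset.univ.image y, ?_, ?_⟩
  · rw [Finset.card_image_of_injective _ hmono.injective, Finset.card_fin]
  · simpa using hy0

/-- A nonempty sum of `n` real exponentials with distinct exponents and nonzero coefficients
has fewer than `n` real zeros. -/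
theorem card_zeros_exp_sum_lt {ι : Type*} {s : ι → ℝ} (hs : Function.Injective s)
    {S : Finset ι} (hS : S.Nonempty) (c : ι → ℝ) (hc : ∀ i ∈ S, c i ≠ 0) (T : Finset ℝ)
    (hT : ∀ t ∈ T, ∑ i ∈ S, c i * Real.exp (s i * t) = 0) : T.card < S.card := by
  induction hS using Finset.Nonempty.cons_induction generalizing c T with
  | singleton a =>
    have hT0 : T = ∅ := Finset.eq_empty_of_forall_notMem fun t ht =>
      hc a (Finset.mem_singleton_self a) (by simpa using hT t ht)
    simp [hT0]
  | cons a S ha hS ih =>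
    rw [Finset.card_cons]
    obtain h0 | ⟨n, hn⟩ : T.card = 0 ∨ ∃ n, T.card = n + 1 := by
      cases h : T.card <;> simp
    · omega
    have hderiv : ∀ t, HasDerivAt (fun t => c a + ∑ i ∈ S, c i * Real.exp ((s i - s a) * t))
        (∑ i ∈ S, c i * (Real.exp ((s i - s a) * t) * ((s i - s a) * 1))) t := fun t =>
      (HasDerivAt.fun_sum fun i _ =>
        (((hasDerivAt_id t).const_mul (s i - s a)).exp.const_mul (c i))).const_add (c a)
    have hexp : ∀ i t, Real.exp ((s i - s a) * t) =
        Real.exp (s i * t) * Real.exp (-(s a * t)) := fun i t => by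
      rw [← Real.exp_add]; ring_nf
    obtain ⟨T', hcard, hT'⟩ := exists_finset_deriv_zeros hderiv hn fun t ht => by
      have h := congrArg (· * Real.exp (-(s a * t))) (hT t ht)
      simp only [Finset.sum_cons, add_mul, Finset.sum_mul, zero_mul, mul_assoc, ← hexp] at h
      simpa using h
    have := ih (fun i => c i * (s i - s a))
      (fun i hi => mul_ne_zero (hc i (Finset.mem_cons_of_mem hi))
        (sub_ne_zero.mpr (hs.ne (ne_of_mem_of_not_mem hi ha)))) T' fun t ht => by
      refine (mul_eq_zero.mp ?_).resolve_right (Real.exp_ne_zero (-(s a * t)))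
      rw [← hT' t ht, Finset.sum_mul]
      refine Finset.sum_congr rfl fun i _ => ?_
      rw [hexp]; ring
    omega

/-- For centers `s₀ < s₁ < ⋯ < s_N` and coefficients `λ₀, …, λ_N` not all zero, the
function `u t = ∑ j, λ j * exp (-(s j - t)²)` has at most `N` zeros in `ℝ`. -/
theorem gaussian_translates_chebyshev (N : ℕ) (s : Fin (N + 1) → ℝ) (hs : StrictMono s)
    (lam : Fin (N + 1) → ℝ) (hlam : lam ≠ 0) :
    {t : ℝ | ∑ j : Fin (N + 1), lam j * Real.exp (-(s j - t) ^ 2) = 0}.encard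
      ≤ (N : ℕ∞) := by
  by_contra! hlt
  obtain ⟨U, hU, hUcard⟩ := Set.exists_subset_encard_eq (Order.add_one_le_of_lt hlt)
  obtain ⟨T, rfl⟩ := (Set.finite_of_encard_eq_coe (k := N + 1) hUcard).exists_finset_coe
  have hTcard : T.card = N + 1 := by
    rw [Set.encard_coe_eq_coe_finsetCard] at hUcard
    exact_mod_cast hUcard
  obtain ⟨j, hj⟩ := Function.ne_iff.mp hlam
  have hlt := card_zeros_exp_sum_lt (s := fun i => 2 * s i)
    (fun i k h => hs.injective (by simpa using h))
    (S := Finset.univ.filter fun i => lam i ≠ 0) ⟨j, by simpa using hj⟩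
    (fun i => lam i * Real.exp (-s i ^ 2)) (fun i hi => by simpa using hi) T fun t ht => by
      have h0 : ∑ i, lam i * Real.exp (-(s i - t) ^ 2) = 0 := hU ht
      rw [Finset.sum_filter_of_ne fun i _ h => left_ne_zero_of_mul (left_ne_zero_of_mul h)]
      refine (mul_eq_zero.mp ?_).resolve_right (Real.exp_ne_zero (-t ^ 2))
      rw [← h0, Finset.sum_mul]
      refine Finset.sum_congr rfl fun i _ => ?_
      rw [mul_assoc, mul_assoc, ← Real.exp_add, ← Real.exp_add]
      ring_nf
  have hle := Finset.card_filter_le (Finset.univ : Finset (Fin (N + 1))) fun i => lam i ≠ 0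
  rw [Finset.card_fin] at hle
  omega
end

section
/- Let N ≥ 0 be an integer and for each i = 0, 1, ..., N let w_i be a function of class C^{N−i} on [a,b] with w_i(t) > 0 for all t ∈ [a,b]. Define u_0(t) = w_0(t), u_1(t) = w_0(t) ∫_a^t w_1(t_1) dt_1, u_2(t) = w_0(t) ∫_a^t w_1(t_1) (∫_a^{t_1} w_2(t_2) dt_2) dt_1, and generally u_k(t) = w_0(t) ∫_a^t w_1(t_1) ∫_a^{t_1} w_2(t_2) ⋯ ∫_a^{t_{k−1}} w_k(t_k) dt_k ⋯ dt_1 for k = 0, ..., N. Then u_0, ..., u_N form an Extended Chebyshev system of order N on [a,b]: whenever λ_0, ..., λ_N are real numbers, t_1, ..., t_m are distinct points of [a,b], and d_1, ..., d_m are nonnegative integers with ∑_{j=1}^{m}(d_j + 1) ≥ N + 1, if the function u = ∑_{k=0}^{N} λ_k u_k satisfies u^{(k)}(t_j) = 0 for all 1 ≤ j ≤ m and 0 ≤ k ≤ d_j, then λ_0 = λ_1 = ⋯ = λ_N = 0. -/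
/-- The nested integral `nestInt w a i k t = ∫_a^t w i (t_i) ∫_a^{t_i} w (i+1) (t_{i+1}) ⋯
∫_a^{t_{k-1}} w k (t_k) dt_k ⋯ dt_i`, equal to `1` when `i > k`. -/
noncomputable def nestInt (w : ℕ → ℝ → ℝ) (a : ℝ) (i k : ℕ) (t : ℝ) : ℝ :=
  if k < i then 1 else ∫ s in a..t, w i s * nestInt w a (i + 1) k s
termination_by k + 1 - i
decreasing_by omega

open Set

section NestedIntegral

variable {w : ℕ → ℝ → ℝ} {a b : ℝ}

theorem nestInt_of_lt {i k : ℕ} (h : k < i) (x : ℝ) : nestInt w a i k x = 1 := by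
  rw [nestInt, if_pos h]

theorem nestInt_of_le {i k : ℕ} (h : i ≤ k) (x : ℝ) :
    nestInt w a i k x = ∫ s in a..x, w i s * nestInt w a (i + 1) k s := by
  rw [nestInt, if_neg h.not_gt]

theorem nestInt_left {i k : ℕ} (h : i ≤ k) : nestInt w a i k a = 0 := by
  rw [nestInt_of_le h, intervalIntegral.integral_same]

theorem ContinuousOn.hasDerivWithinAt_integral_Icc {f : ℝ → ℝ} (hf : ContinuousOn f (Icc a b))
    {x : ℝ} (hx : x ∈ Icc a b) :
    HasDerivWithinAt (fun u => ∫ s in a..u, f s) (f x) (Icc a b) x := by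
  have : Fact (x ∈ Icc a b) := ⟨hx⟩
  refine intervalIntegral.integral_hasDerivWithinAt_right ?_
    (hf.stronglyMeasurableAtFilter_nhdsWithin measurableSet_Icc x) (hf x hx)
  refine ContinuousOn.intervalIntegrable (hf.mono ?_)
  rw [uIcc_of_le hx.1]
  exact Icc_subset_Icc_right hx.2

theorem continuousOn_nestInt {k : ℕ} (hw : ∀ i ≤ k, ContinuousOn (w i) (Icc a b)) (i : ℕ) :
    ContinuousOn (nestInt w a i k) (Icc a b) := by
  by_cases h : k < i
  · exact continuousOn_const.congr fun x _ => nestInt_of_lt h x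
  · rw [not_lt] at h
    have hc := (hw i h).mul (continuousOn_nestInt hw (i + 1))
    have hd : ContinuousOn (fun u => ∫ s in a..u, w i s * nestInt w a (i + 1) k s) (Icc a b) :=
      fun x hx => (hc.hasDerivWithinAt_integral_Icc hx).continuousWithinAt
    exact hd.congr fun x _ => nestInt_of_le h x
termination_by k + 1 - i

theorem hasDerivWithinAt_nestInt {i k : ℕ} (hw : ∀ i ≤ k, ContinuousOn (w i) (Icc a b))
    (h : i ≤ k) {x : ℝ} (hx : x ∈ Icc a b) :
    HasDerivWithinAt (nestInt w a i k) (w i x * nestInt w a (i + 1) k x) (Icc a b) x := by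
  have hc := (hw i h).mul (continuousOn_nestInt hw (i + 1))
  exact (hc.hasDerivWithinAt_integral_Icc hx).congr (fun y _ => nestInt_of_le h y)
    (nestInt_of_le h x)

/-- The `i`-th generalized derivative of `∑ k, lam k * (w 0 * nestInt w a 1 k)` with respect to
the weights `w`. -/
noncomputable def nestIntSum (w : ℕ → ℝ → ℝ) (a : ℝ) {N : ℕ} (lam : Fin (N + 1) → ℝ) (i : ℕ)
    (x : ℝ) : ℝ :=
  ∑ k : Fin (N + 1), if i ≤ k then lam k * nestInt w a (i + 1) k x else 0

theorem nestIntSum_left {N : ℕ} (lam : Fin (N + 1) → ℝ) (i : Fin (N + 1)) :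
    nestIntSum w a lam i a = lam i := by
  rw [nestIntSum, Finset.sum_eq_single i]
  · simp [nestInt_of_lt]
  · intro k _ hk
    split_ifs with h
    · have : (i : ℕ) ≠ k := fun h => hk (Fin.ext h.symm)
      rw [nestInt_left (by omega), mul_zero]
    · rfl
  · simp

theorem nestIntSum_last {N : ℕ} (lam : Fin (N + 1) → ℝ) (x : ℝ) :
    nestIntSum w a lam N x = lam (Fin.last N) := by
  rw [nestIntSum, Finset.sum_eq_single (Fin.last N)]
  · simp [nestInt_of_lt]
  · intro k _ hk
    have : (k : ℕ) ≠ N := fun h => hk (Fin.ext h)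
    rw [if_neg (by omega)]
  · simp

theorem hasDerivWithinAt_nestIntSum {N : ℕ} (hw : ∀ i ≤ N, ContinuousOn (w i) (Icc a b))
    (lam : Fin (N + 1) → ℝ) (i : ℕ) {x : ℝ} (hx : x ∈ Icc a b) :
    HasDerivWithinAt (nestIntSum w a lam i) (w (i + 1) x * nestIntSum w a lam (i + 1) x)
      (Icc a b) x := by
  unfold nestIntSum
  rw [Finset.mul_sum]
  refine HasDerivWithinAt.fun_sum fun k _ => ?_
  rcases lt_trichotomy i k with h | h | h
  · simp only [if_pos h.le, if_pos (show i + 1 ≤ (k : ℕ) from h)]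
    exact ((hasDerivWithinAt_nestInt (fun j hj => hw j (by omega)) h hx).const_mul
      (lam k)).congr_deriv (mul_left_comm ..)
  · simp only [if_pos h.le, if_neg (show ¬ i + 1 ≤ (k : ℕ) by omega),
      nestInt_of_lt (show (k : ℕ) < i + 1 by omega), mul_zero]
    exact hasDerivWithinAt_const ..
  · simp only [if_neg h.not_ge, if_neg (show ¬ i + 1 ≤ (k : ℕ) by omega), mul_zero]
    exact hasDerivWithinAt_const ..

end NestedIntegral

/-- **Rolle's theorem**, counting zeros: strictly between consecutive points of a finite set of
zeros of `f` there is a zero of `g`, if `f' = p * g` with `p` nonvanishing. -/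
theorem exists_finset_zeros_of_hasDerivWithinAt {a b : ℝ} {f p g : ℝ → ℝ}
    (hp : ∀ x ∈ Icc a b, p x ≠ 0)
    (hf : ∀ x ∈ Icc a b, HasDerivWithinAt f (p x * g x) (Icc a b) x)
    (T : Finset ℝ) (hT : ∀ x ∈ T, x ∈ Icc a b) (hfT : ∀ x ∈ T, f x = 0) :
    ∃ R : Finset ℝ, Disjoint T R ∧ T.card ≤ R.card + 1 ∧ ∀ x ∈ R, x ∈ Icc a b ∧ g x = 0 := by
  have rolle : ∀ x y, x ∈ T → y ∈ T → x < y → ∃ z, (x < z ∧ z < y) ∧ g z = 0 := by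
    intro x y hx hy hxy
    have hsub : Icc x y ⊆ Icc a b := Icc_subset_Icc (hT x hx).1 (hT y hy).2
    obtain ⟨z, hz, hz0⟩ := exists_hasDerivAt_eq_zero (f' := fun z => p z * g z) hxy
      (fun z hz => ((hf z (hsub hz)).continuousWithinAt).mono hsub)
      ((hfT x hx).trans (hfT y hy).symm)
      (fun z hz => ((hf z (hsub (Ioo_subset_Icc_self hz))).mono hsub).hasDerivAt
        (Icc_mem_nhds hz.1 hz.2))
    exact ⟨z, hz, (mul_eq_zero.1 hz0).resolve_left (hp z (hsub (Ioo_subset_Icc_self hz)))⟩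
  choose! c hc hc0 using rolle
  let S : Finset ℝ := ((T ×ˢ T).filter fun q => q.1 < q.2).image fun q => c q.1 q.2
  refine ⟨S \ T, Finset.disjoint_sdiff, ?_, ?_⟩
  · refine Finset.card_le_sdiff_of_interleaved fun x hx y hy hxy _ => ⟨c x y, ?_, hc x y hx hy hxy⟩
    exact Finset.mem_image.2 ⟨(x, y), by simp [hx, hy, hxy], rfl⟩
  · intro z hz
    obtain ⟨⟨x, y⟩, hq, rfl⟩ := Finset.mem_image.1 (Finset.mem_sdiff.1 hz).1
    simp only [Finset.mem_filter, Finset.mem_product] at hq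
    obtain ⟨⟨hx, hy⟩, hxy⟩ := hq
    have := hc x y hx hy hxy
    exact ⟨⟨(hT x hx).1.trans this.1.le, this.2.le.trans (hT y hy).2⟩, hc0 x y hx hy hxy⟩

/-- A chain of functions `g 0, …, g N` with `(g i)' = p i * g (i + 1)` and `g N` constant vanishes
identically as soon as `g 0` has `N + 1` zeros, counted with multiplicity `μ`. -/
theorem eqOn_zero_of_card_zeros {a b : ℝ} (N : ℕ) (p g : ℕ → ℝ → ℝ)
    (hp : ∀ i < N, ∀ x ∈ Icc a b, p i x ≠ 0)
    (hg : ∀ i < N, ∀ x ∈ Icc a b, HasDerivWithinAt (g i) (p i x * g (i + 1) x) (Icc a b) x)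
    {c : ℝ} (hc : ∀ x ∈ Icc a b, g N x = c)
    (T : Finset ℝ) (hT : ∀ x ∈ T, x ∈ Icc a b) (μ : ℝ → ℕ) (hμ : N + 1 ≤ ∑ x ∈ T, μ x)
    (hz : ∀ x ∈ T, ∀ k ≤ N, k < μ x → g k x = 0) :
    ∀ i ≤ N, ∀ x ∈ Icc a b, g i x = 0 := by
  induction N generalizing p g T μ with
  | zero =>
    obtain ⟨y, hy, hy0⟩ : ∃ y ∈ T, μ y ≠ 0 := Finset.exists_ne_zero_of_sum_ne_zero (by omega)
    intro i hi x hx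
    obtain rfl : i = 0 := by omega
    rw [hc x hx, ← hc y (hT y hy), hz y hy 0 le_rfl (by omega)]
  | succ N ih =>
    wlog hpos : ∀ x ∈ T, 0 < μ x generalizing T
    · refine this (T.filter fun x => 0 < μ x) (fun x hx => hT x (Finset.mem_filter.1 hx).1) ?_
        (fun x hx => hz x (Finset.mem_filter.1 hx).1) (fun x hx => (Finset.mem_filter.1 hx).2)
      rwa [Finset.sum_filter_of_ne fun x _ h => Nat.pos_of_ne_zero h]
    obtain ⟨R, hTR, hcard, hR⟩ := exists_finset_zeros_of_hasDerivWithinAt (hp 0 (by omega))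
      (hg 0 (by omega)) T hT fun x hx => hz x hx 0 (by omega) (hpos x hx)
    have htail : ∀ i ≤ N, ∀ x ∈ Icc a b, g (i + 1) x = 0 := by
      refine ih (fun i => p (i + 1)) (fun i => g (i + 1)) (fun i hi => hp (i + 1) (by omega))
        (fun i hi => hg (i + 1) (by omega)) hc (T ∪ R) ?_
        (fun x => if x ∈ T then μ x - 1 else 1) ?_ ?_
      · intro x hx
        exact (Finset.mem_union.1 hx).elim (hT x) fun h => (hR x h).1
      · rw [Finset.sum_union hTR, Finset.sum_congr rfl fun x hx => if_pos hx,
          Finset.sum_congr (s₁ := R) rfl fun x hx => if_neg (Finset.disjoint_right.1 hTR hx)]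
        have : ∑ x ∈ T, μ x = ∑ x ∈ T, (μ x - 1) + T.card := by
          rw [Finset.card_eq_sum_ones, ← Finset.sum_add_distrib]
          exact Finset.sum_congr rfl fun x hx => by have := hpos x hx; omega
        simp only [Finset.sum_const, smul_eq_mul, mul_one]
        omega
      · intro x hx k hk hkμ
        by_cases hxT : x ∈ T
        · rw [if_pos hxT] at hkμ
          exact hz x hxT (k + 1) (by omega) (by omega)
        · rw [if_neg hxT] at hkμ
          obtain rfl : k = 0 := by omega
          exact (hR x ((Finset.mem_union.1 hx).resolve_left hxT)).2
    obtain ⟨y, hy, -⟩ : ∃ y ∈ T, μ y ≠ 0 := Finset.exists_ne_zero_of_sum_ne_zero (by omega)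
    have hconst : ∀ x ∈ Icc a b, g 0 x = g 0 a := by
      refine constant_of_has_deriv_right_zero
        (fun x hx => (hg 0 (by omega) x hx).continuousWithinAt) fun x hx => ?_
      have h := hg 0 (by omega) x (Ico_subset_Icc_self hx)
      rw [htail 0 (by omega) x (Ico_subset_Icc_self hx), mul_zero] at h
      exact h.mono_of_mem_nhdsWithin (Icc_mem_nhdsGE_of_mem hx)
    rintro (_ | i) hi x hx
    · rw [hconst x hx, ← hconst y (hT y hy), hz y hy 0 (by omega) (hpos y hy)]
    · exact htail i (by omega) x hx

theorem iteratedDerivWithin_mul_eq_zero {s : Set ℝ} (hs : UniqueDiffOn ℝ s) {f g : ℝ → ℝ} {n : ℕ}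
    (hf : ContDiffOn ℝ n f s) (hg : ContDiffOn ℝ n g s) {x : ℝ} (hx : x ∈ s)
    (hz : ∀ k ≤ n, iteratedDerivWithin k f s x = 0) :
    ∀ k ≤ n, iteratedDerivWithin k (f * g) s x = 0 := by
  intro k hk
  have hkn : (k : WithTop ℕ∞) ≤ n := by exact_mod_cast hk
  rw [iteratedDerivWithin_mul hx hs ((hf.of_le hkn) x hx) ((hg.of_le hkn) x hx)]
  refine Finset.sum_eq_zero fun i hi => ?_
  rw [hz i (by have := Finset.mem_range.1 hi; omega), mul_zero, zero_mul]

/-- If `(g i)' = p (i + 1) * g (i + 1)` and `g N` is constant, then `g i` is of class `C^{N-i}`. -/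
theorem contDiffOn_of_hasDerivWithinAt_chain {s : Set ℝ} (hs : UniqueDiffOn ℝ s) {N : ℕ}
    {p g : ℕ → ℝ → ℝ} (hreg : ∀ i ≤ N, ContDiffOn ℝ (N - i : ℕ) (p i) s)
    (hg : ∀ i < N, ∀ x ∈ s, HasDerivWithinAt (g i) (p (i + 1) x * g (i + 1) x) s x)
    (hc : ContDiffOn ℝ 0 (g N) s) (n i : ℕ) (hi : i + n = N) : ContDiffOn ℝ n (g i) s := by
  induction n generalizing i with
  | zero =>
    obtain rfl : i = N := by omega
    exact hc
  | succ n ih =>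
    push_cast
    rw [contDiffOn_succ_iff_derivWithin hs]
    refine ⟨fun x hx => (hg i (by omega) x hx).differentiableWithinAt, by simp, ?_⟩
    have hp := hreg (i + 1) (by omega)
    rw [show N - (i + 1) = n by omega] at hp
    exact (hp.mul (ih (i + 1) (by omega))).congr fun x hx =>
      (hg i (by omega) x hx).derivWithin (hs x hx)

/-- If the derivatives up to order `d` of `p i * g i` vanish at `x`, where
`(g i)' = p (i + 1) * g (i + 1)` and the weights `p i` do not vanish, then
`g i, …, g (i + d)` vanish at `x`. -/
theorem chain_eq_zero_of_iteratedDerivWithin_eq_zero {s : Set ℝ} (hs : UniqueDiffOn ℝ s) {N : ℕ}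
    {p g : ℕ → ℝ → ℝ} (hreg : ∀ i ≤ N, ContDiffOn ℝ (N - i : ℕ) (p i) s)
    (hp : ∀ i ≤ N, ∀ x ∈ s, p i x ≠ 0)
    (hg : ∀ i < N, ∀ x ∈ s, HasDerivWithinAt (g i) (p (i + 1) x * g (i + 1) x) s x)
    (hc : ContDiffOn ℝ 0 (g N) s) {x : ℝ} (hx : x ∈ s) (d i : ℕ) (hid : i + d ≤ N)
    (hz : ∀ k ≤ d, iteratedDerivWithin k (p i * g i) s x = 0) :
    ∀ k ≤ d, g (i + k) x = 0 := by
  induction d generalizing i with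
  | zero =>
    intro k hk
    obtain rfl : k = 0 := by omega
    have h := hz 0 le_rfl
    rw [iteratedDerivWithin_zero] at h
    exact (mul_eq_zero.1 h).resolve_left (hp i (by omega) x hx)
  | succ d ih =>
    have hle : ((d + 1 : ℕ) : WithTop ℕ∞) ≤ (N - i : ℕ) := by
      exact_mod_cast (show d + 1 ≤ N - i by omega)
    have hpi : ContDiffOn ℝ (d + 1 : ℕ) (p i) s := (hreg i (by omega)).of_le hle
    have hgi : ContDiffOn ℝ (d + 1 : ℕ) (g i) s :=
      (contDiffOn_of_hasDerivWithinAt_chain hs hreg hg hc (N - i) i (by omega)).of_le hle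
    have hz' : ∀ k ≤ d + 1, iteratedDerivWithin k (g i) s x = 0 := by
      intro k hk
      rw [← iteratedDerivWithin_mul_eq_zero hs (hpi.mul hgi) (hpi.inv (hp i (by omega))) hx hz k hk]
      refine iteratedDerivWithin_congr (fun y hy => ?_) hx
      have := hp i (by omega) y hy
      simp only [Pi.mul_apply, Pi.inv_apply]
      field_simp
    have hder : ∀ k ≤ d, iteratedDerivWithin k (p (i + 1) * g (i + 1)) s x = 0 := by
      intro k hk
      rw [← hz' (k + 1) (by omega), iteratedDerivWithin_succ']
      exact iteratedDerivWithin_congr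
        (fun y hy => ((hg i (by omega) y hy).derivWithin (hs y hy)).symm) hx
    rintro (_ | k) hk
    · simpa using hz' 0 (by omega)
    · rw [show i + (k + 1) = i + 1 + k by omega]
      exact ih (i + 1) (by omega) hder k (by omega)

/-- If `w₀, …, w_N` are positive, with `w i` of class `C^{N-i}` on `[a,b]`, then the
functions `u_k t = w₀ t * ∫_a^t w₁(t₁) ⋯ ∫_a^{t_{k-1}} w_k(t_k) dt_k ⋯ dt₁`,
`k = 0, …, N`, form an Extended Chebyshev system of order `N` on `[a,b]`: a linear
combination having at least `N+1` zeros in `[a,b]` counted with multiplicities must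
have all coefficients zero. -/
theorem nested_integrals_extended_chebyshev (a b : ℝ) (hab : a < b) (N : ℕ)
    (w : ℕ → ℝ → ℝ)
    (hreg : ∀ i : ℕ, i ≤ N → ContDiffOn ℝ (N - i : ℕ) (w i) (Set.Icc a b))
    (hpos : ∀ i : ℕ, i ≤ N → ∀ t ∈ Set.Icc a b, 0 < w i t)
    (lam : Fin (N + 1) → ℝ)
    (m : ℕ) (t : Fin m → ℝ) (htmem : ∀ j, t j ∈ Set.Icc a b)
    (htinj : Function.Injective t)
    (d : Fin m → ℕ) (hd : N + 1 ≤ ∑ j, (d j + 1))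
    (hzero : ∀ (j : Fin m) (k : ℕ), k ≤ d j →
      iteratedDerivWithin k
        (fun x => ∑ i : Fin (N + 1), lam i * (w 0 x * nestInt w a 1 i x))
        (Set.Icc a b) (t j) = 0) :
    lam = 0 := by
  have hs := uniqueDiffOn_Icc hab
  have hcont : ∀ i ≤ N, ContinuousOn (w i) (Set.Icc a b) := fun i hi => (hreg i hi).continuousOn
  have hne : ∀ i ≤ N, ∀ x ∈ Set.Icc a b, w i x ≠ 0 := fun i hi x hx => (hpos i hi x hx).ne'
  have hder : ∀ i < N, ∀ x ∈ Set.Icc a b, HasDerivWithinAt (nestIntSum w a lam i)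
      (w (i + 1) x * nestIntSum w a lam (i + 1) x) (Set.Icc a b) x :=
    fun i _ x hx => hasDerivWithinAt_nestIntSum hcont lam i hx
  have hlast : ContDiffOn ℝ 0 (nestIntSum w a lam N) (Set.Icc a b) :=
    contDiffOn_const.congr fun x _ => nestIntSum_last lam x
  have hfun : (fun x => ∑ i : Fin (N + 1), lam i * (w 0 x * nestInt w a 1 i x)) =
      w 0 * nestIntSum w a lam 0 := by
    funext x
    simp only [Pi.mul_apply, nestIntSum, Nat.zero_le, if_true, zero_add, Finset.mul_sum]
    exact Finset.sum_congr rfl fun i _ => by ring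
  rw [hfun] at hzero
  have hz : ∀ j, ∀ k ≤ N, k < d j + 1 → nestIntSum w a lam k (t j) = 0 := by
    intro j k hkN hk
    simpa using chain_eq_zero_of_iteratedDerivWithin_eq_zero hs hreg hne hder hlast (htmem j) k 0
      (by omega) (fun l hl => hzero j l (by omega)) k le_rfl
  have hall := eqOn_zero_of_card_zeros N (fun i => w (i + 1)) (nestIntSum w a lam)
    (fun i hi => hne (i + 1) hi) hder (fun x _ => nestIntSum_last lam x)
    (Finset.univ.image t) (by simpa using htmem) (Function.extend t (fun j => d j + 1) 0)
    (by simpa [Finset.sum_image htinj.injOn, htinj.extend_apply] using hd)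
    (by simpa [htinj.extend_apply, Nat.lt_succ_iff] using hz)
  funext i
  rw [← nestIntSum_left (w := w) (a := a) lam i]
  exact hall i (by omega) a (Set.left_mem_Icc.2 hab.le)
end
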